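/- arXiv:0811.2389 — 2 statements merged into one kernel-verified Lean document; each statement's English description precedes it below -/
import Mathlib

section
/- Let G be a finitely generated group, E an admissible family of subgroups of G, and T a minimal E-tree with basepoint vertex v₀. If S and S' are special forests of T, then X_S ∩ X_{S'} is small if and only if S ∩ S' is finite. -/
open scoped Pointwise symmDiff

namespace SSRN

section Group
variable {G : Type*} [Group G]

/-- A subset of `G` is `H`-finite if it is contained in finitely many orbits of the
action of `H` on `G` by left multiplication. -/
def HFin (H : Subgroup G) (X : Set G) : Prop :=
  ∃ F : Finset G, X ⊆ ⋃ f ∈ F, (· * f) '' (H : Set G)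

/-- Two subsets of `G` are `H`-equivalent if their symmetric difference is `H`-finite. -/
def AIEquiv (H : Subgroup G) (X Y : Set G) : Prop := HFin H (X ∆ Y)

/-- `X` is an `H`-almost invariant subset of `G`. -/
def IsAI (H : Subgroup G) (X : Set G) : Prop :=
  (∀ h ∈ H, (h * ·) '' X = X) ∧ ∀ s : G, HFin H (((· * s) '' X) ∆ X)

/-- `X` is a non-trivial `H`-almost invariant subset of `G`. -/
def NontrivAI (H : Subgroup G) (X : Set G) : Prop :=
  IsAI H X ∧ ¬ HFin H X ∧ ¬ HFin H Xᶜ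

/-- The `H`-almost invariant set `X` crosses `Y`: none of the four corners is `H`-finite. -/
def Crosses (H : Subgroup G) (X Y : Set G) : Prop :=
  ¬ HFin H (X ∩ Y) ∧ ¬ HFin H (X ∩ Yᶜ) ∧ ¬ HFin H (Xᶜ ∩ Y) ∧ ¬ HFin H (Xᶜ ∩ Yᶜ)

/-- Crossing of (non-trivial) almost invariant sets, quantifying over the groups over
which they are almost invariant. -/
def CrossesAny (X X' : Set G) : Prop :=
  ∃ H K : Subgroup G, NontrivAI H X ∧ NontrivAI K X' ∧ Crosses H X X'

/-- `X` and `X'` determine the same unordered pair `{[X], [X*]}` of equivalence classes. -/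
def SamePair (X X' : Set G) : Prop :=
  ∃ H : Subgroup G, NontrivAI H X ∧ (HFin H (X ∆ X') ∨ HFin H (X ∆ X'ᶜ))

/-- An admissible family of subgroups: conjugacy invariant, closed under commensurability,
and no member contains another with infinite index. -/
def Admissible (E : Set (Subgroup G)) : Prop :=
  (∀ H ∈ E, ∀ g : G, (MulAut.conj g • H) ∈ E) ∧
  (∀ H ∈ E, ∀ K : Subgroup G, Subgroup.Commensurable K H → K ∈ E) ∧
  (∀ A ∈ E, ∀ B ∈ E, A ≤ B → A.relIndex B ≠ 0)

end Group

section Tree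

variable {V : Type*}

/-- The stabilizer of an edge `e : Sym2 V` under the action of `G`. -/
def edgeStab (G : Type*) [Group G] [MulAction G V] (e : Sym2 V) : Subgroup G where
  carrier := {g | Sym2.map (g • ·) e = e}
  one_mem' := by
    show Sym2.map ((1 : G) • ·) e = e
    have : ((1 : G) • · : V → V) = id := by funext v; simp
    rw [this, Sym2.map_id]; rfl
  mul_mem' := by
    intro a b ha hb
    show Sym2.map ((a * b) • ·) e = e
    have : ((a * b) • · : V → V) = (a • ·) ∘ (b • ·) := by funext v; simp [mul_smul]
    rw [this, ← Sym2.map_map, hb, ha]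
  inv_mem' := by
    intro a ha
    show Sym2.map (a⁻¹ • ·) e = e
    conv_lhs => rw [← ha]
    rw [Sym2.map_map]
    have : ((a⁻¹ • ·) ∘ (a • ·) : V → V) = id := by funext v; simp
    rw [this, Sym2.map_id]; rfl

variable (T : SimpleGraph V)

/-- `G` acts on the graph `T` by graph automorphisms. -/
def ActsOn (G : Type*) [Group G] [MulAction G V] : Prop :=
  ∀ (g : G) (u v : V), T.Adj u v → T.Adj (g • u) (g • v)

/-- The action of `G` on `T` is without inversions. -/
def NoInversions (G : Type*) [Group G] [MulAction G V] : Prop :=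
  ∀ (g : G) (u v : V), T.Adj u v → ¬ (g • u = v ∧ g • v = u)

/-- `w` lies between `u` and `v`: it is on every path from `u` to `v`. -/
def Btw (u w v : V) : Prop := ∀ p : T.Walk u v, p.IsPath → w ∈ p.support

/-- The action of `G` on the tree `T` is minimal: every nonempty invariant subtree
(convex invariant set of vertices) is the whole vertex set. -/
def MinimalAction (G : Type*) [Group G] [MulAction G V] : Prop :=
  ∀ A : Set V, A.Nonempty → (∀ (g : G), ∀ a ∈ A, g • a ∈ A) →
    (∀ u ∈ A, ∀ v ∈ A, ∀ w : V, Btw T u w v → w ∈ A) → A = Set.univ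

/-- The action of `G` is non-trivial: there is no global fixed vertex. -/
def NontrivialAction (G : Type*) [Group G] [MulAction G V] : Prop :=
  ¬ ∃ v : V, ∀ g : G, g • v = v

/-- `T` is an `E`-tree: all edge stabilizers belong to `E`. -/
def IsETree (G : Type*) [Group G] [MulAction G V] (E : Set (Subgroup G)) : Prop :=
  ∀ e ∈ T.edgeSet, edgeStab G e ∈ E

/-- There are finitely many `G`-orbits of edges. -/
def FinEdgeOrbits (G : Type*) [Group G] [MulAction G V] : Prop :=
  ∃ F : Finset (Sym2 V), ∀ e ∈ T.edgeSet, ∃ e₀ ∈ F, ∃ g : G, Sym2.map (g • ·) e₀ = e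

/-- A cylinder of `T`: an equivalence class of edges for commensurability of stabilizers. -/
def IsCylinder (G : Type*) [Group G] [MulAction G V] (Y : Set (Sym2 V)) : Prop :=
  Y.Nonempty ∧ Y ⊆ T.edgeSet ∧
    ∀ e ∈ Y, ∀ e' ∈ T.edgeSet,
      (e' ∈ Y ↔ Subgroup.Commensurable (edgeStab G e) (edgeStab G (V := V) e'))

/-- The set of vertices of a set of edges (e.g. of a cylinder). -/
def cylVerts (Y : Set (Sym2 V)) : Set V := {v | ∃ e ∈ Y, v ∈ e}

/-- The boundary of a cylinder: its vertices lying in another cylinder,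
i.e. incident to an edge outside the cylinder. -/
def cylBoundary (Y : Set (Sym2 V)) : Set V :=
  {v | v ∈ cylVerts Y ∧ ∃ e ∈ T.edgeSet, v ∈ e ∧ e ∉ Y}

/-- `H` belongs to the commensurability class associated to the cylinder `Y`. -/
def InClassOf (G : Type*) [Group G] [MulAction G V] (Y : Set (Sym2 V)) (H : Subgroup G) : Prop :=
  ∃ e ∈ Y, Subgroup.Commensurable H (edgeStab G e)

/-- The coboundary of a set of vertices: edges with exactly one endpoint in it. -/
def cobdry (S : Set V) : Set (Sym2 V) :=
  {e | e ∈ T.edgeSet ∧ ∃ u v : V, e = s(u, v) ∧ u ∈ S ∧ v ∉ S}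

/-- `S` is a special forest based on the cylinder `Y`. -/
def IsSpecialForest (S : Set V) (Y : Set (Sym2 V)) : Prop :=
  (cobdry T S).Finite ∧ cobdry T S ⊆ Y

/-- A set of vertices is non-trivial if it is neither finite nor cofinite. -/
def NontrivForest (S : Set V) : Prop := ¬ S.Finite ∧ ¬ (Sᶜ : Set V).Finite

/-- The almost invariant set associated to a set of vertices. -/
def XS (G : Type*) [Group G] [MulAction G V] (v₀ : V) (S : Set V) : Set G :=
  {g : G | g • v₀ ∈ S}

/-- The component `T_e` of `T` minus the open edge `e = s(u,v)` containing the terminal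
vertex `v`. -/
def halfTree (u v : V) : Set V :=
  {w | ∃ p : T.Walk v w, p.IsPath ∧ s(u, v) ∉ p.edges}

/-- The almost invariant set `Z_e` dual to the oriented edge `(u, v)`. -/
def Ze (G : Type*) [Group G] [MulAction G V] (v₀ u v : V) : Set G :=
  XS G v₀ (halfTree T u v)

/-- `v` has finitely many incident edges in `Y`. -/
def FiniteValenceIn (Y : Set (Sym2 V)) (v : V) : Prop := {e | e ∈ Y ∧ v ∈ e}.Finite

/-- The peripheral special forest `S_{v,Y}`: the component of `v` in `T` minus the open
edges of `Y` incident to `v`. -/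
def periForest (Y : Set (Sym2 V)) (v : V) : Set V :=
  {w | ∃ p : T.Walk v w, p.IsPath ∧ ∀ e ∈ Y, v ∈ e → e ∉ p.edges}

/-- The peripheral almost invariant set `X_{v,Y}`. -/
def XvY (G : Type*) [Group G] [MulAction G V] (v₀ : V) (Y : Set (Sym2 V)) (v : V) : Set G :=
  XS G v₀ (periForest T Y v)

/-- A peripheral special forest: one equivalent to some `S_{v,Y}`. -/
def PeripheralForest (G : Type*) [Group G] [MulAction G V] (S : Set V) : Prop :=
  ∃ (Y : Set (Sym2 V)) (v : V), IsCylinder T G Y ∧ v ∈ cylBoundary T Y ∧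
    FiniteValenceIn Y v ∧ (S ∆ periForest T Y v).Finite

/-- The Boolean algebra `B_C(T)` of (representatives of) almost invariant sets based on the
cylinder `Y`: the smallest family containing the sets `Z_e`, `e ∈ Y`, closed under
complement, intersection and `H`-equivalence. -/
def BCT {G : Type*} [Group G] [MulAction G V] (v₀ : V) (Y : Set (Sym2 V)) (H : Subgroup G) :
    Set (Set G) :=
  ⋂₀ {F : Set (Set G) |
    (∀ u v : V, T.Adj u v → s(u, v) ∈ Y → Ze T G v₀ u v ∈ F) ∧
    (∀ X ∈ F, Xᶜ ∈ F) ∧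
    (∀ X ∈ F, ∀ X' ∈ F, X ∩ X' ∈ F) ∧
    (∀ X ∈ F, ∀ X' : Set G, HFin H (X ∆ X') → X' ∈ F)}

/-- The set `B(T)` of (representatives of) almost invariant sets based on `T`. -/
def BT (G : Type*) [Group G] [MulAction G V] (v₀ : V) : Set (Set G) :=
  {X | ∃ Y : Set (Sym2 V), IsCylinder T G Y ∧ ∃ e ∈ Y, X ∈ BCT T v₀ Y (edgeStab G e)}

/-- Elements of `B(T)` that are non-trivial almost invariant sets. -/
def NontrivB (G : Type*) [Group G] [MulAction G V] (v₀ : V) : Set (Set G) :=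
  {X | X ∈ BT T G v₀ ∧ ∃ H : Subgroup G, NontrivAI H X}

/-- One step of the relation generating cross-connected components. -/
def ccStep (G : Type*) [Group G] [MulAction G V] (v₀ : V) (X X' : Set G) : Prop :=
  X ∈ NontrivB T G v₀ ∧ X' ∈ NontrivB T G v₀ ∧ (CrossesAny X X' ∨ SamePair X X')

/-- The equivalence relation generated by crossing (and identification of equivalent sets
and complements) on `B(T)`. -/
def ccRel (G : Type*) [Group G] [MulAction G V] (v₀ : V) : Set G → Set G → Prop :=
  Relation.EqvGen (ccStep T G v₀)

/-- The cross-connected component of (the pair determined by) `X`. -/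
def ccOf (G : Type*) [Group G] [MulAction G V] (v₀ : V) (X : Set G) : Set (Set G) :=
  {X' | ccRel T G v₀ X X'}

/-- `C` is a cross-connected component of `B(T)`. -/
def IsCCC (G : Type*) [Group G] [MulAction G V] (v₀ : V) (C : Set (Set G)) : Prop :=
  ∃ X ∈ NontrivB T G v₀, C = ccOf T G v₀ X

/-- A cross-connected component is based on the cylinder `Y` if its members are almost
invariant over subgroups in the commensurability class of `Y`. -/
def CCCBasedOn (G : Type*) [Group G] [MulAction G V] (Y : Set (Sym2 V)) (C : Set (Set G)) :
    Prop :=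
  ∃ X ∈ C, ∃ H : Subgroup G, InClassOf G Y H ∧ NontrivAI H X

/-- A peripheral cross-connected component. -/
def PeripheralCCC (G : Type*) [Group G] [MulAction G V] (v₀ : V) (C : Set (Set G)) : Prop :=
  ∃ (Y : Set (Sym2 V)) (v : V), IsCylinder T G Y ∧ v ∈ cylBoundary T Y ∧
    FiniteValenceIn Y v ∧ XvY T G v₀ Y v ∈ C

/-- Betweenness of (distinct) cross-connected components. -/
def CCCBetween {G : Type*} [Group G] (C₁ C₂ C₃ : Set (Set G)) : Prop :=
  C₁ ≠ C₂ ∧ C₂ ≠ C₃ ∧ C₁ ≠ C₃ ∧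
    ∃ X₁ ∈ C₁, ∃ X₂ ∈ C₂, ∃ X₃ ∈ C₃, X₁ ⊆ X₂ ∧ X₂ ⊆ X₃

/-- A star of cross-connected components. -/
def IsStar (G : Type*) [Group G] [MulAction G V] (v₀ : V) (St : Set (Set (Set G))) : Prop :=
  (∀ C ∈ St, IsCCC T G v₀ C) ∧ St.Nontrivial ∧
  (∀ C ∈ St, ∀ C' ∈ St, ∀ C'' : Set (Set G), IsCCC T G v₀ C'' → ¬ CCCBetween C C'' C') ∧
  (∀ St' : Set (Set (Set G)), St ⊆ St' → (∀ C ∈ St', IsCCC T G v₀ C) →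
    (∀ C ∈ St', ∀ C' ∈ St', ∀ C'' : Set (Set G), IsCCC T G v₀ C'' → ¬ CCCBetween C C'' C') →
    St' = St)

/-- The regular neighbourhood `RN(B(T))`: the bipartite graph on cross-connected
components and stars. -/
def RNGraph (G : Type*) [Group G] [MulAction G V] (v₀ : V) :
    SimpleGraph ({C : Set (Set G) // IsCCC T G v₀ C} ⊕
      {St : Set (Set (Set G)) // IsStar T G v₀ St}) where
  Adj x y :=
    match x, y with
    | Sum.inl C, Sum.inr St => C.1 ∈ St.1
    | Sum.inr St, Sum.inl C => C.1 ∈ St.1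
    | _, _ => False
  symm := ⟨by rintro (C | St) (C' | St') h <;> exact h⟩
  loopless := ⟨by rintro (C | St) h <;> exact h⟩

/-- Vertices of `T` lying in at least two cylinders. -/
def TcV0 (G : Type*) [Group G] [MulAction G V] : Set V :=
  {v | ∃ Y Y' : Set (Sym2 V), IsCylinder T G Y ∧ IsCylinder T G Y' ∧ Y ≠ Y' ∧
    v ∈ cylVerts Y ∧ v ∈ cylVerts Y'}

/-- The tree of cylinders `T_c` of `T`, as a bipartite graph. -/
def TcGraph (G : Type*) [Group G] [MulAction G V] :
    SimpleGraph ({v : V // v ∈ TcV0 T G} ⊕ {Y : Set (Sym2 V) // IsCylinder T G Y}) where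
  Adj x y :=
    match x, y with
    | Sum.inl v, Sum.inr Y => v.1 ∈ cylVerts Y.1
    | Sum.inr Y, Sum.inl v => v.1 ∈ cylVerts Y.1
    | _, _ => False
  symm := ⟨by rintro (v | Y) (v' | Y') h <;> exact h⟩
  loopless := ⟨by rintro (v | Y) h <;> exact h⟩


/-- `T` dominates `T'`: there is a `G`-equivariant map. -/
def Dominates (G : Type*) [Group G] {V V' : Type*} [MulAction G V] [MulAction G V']
    (T : SimpleGraph V) (T' : SimpleGraph V') : Prop :=
  ∃ f : V → V', ∀ (g : G) (x : V), f (g • x) = g • f x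

end Tree

section Subdiv

variable {α β : Type*}

/-- `S` is a subdivision of `Γ` via the vertex embedding `f`. -/
def SubdivVia (f : α → β) (S : SimpleGraph β) (Γ : SimpleGraph α) : Prop :=
  Function.Injective f ∧
  (∀ b : β, b ∉ Set.range f → ∃ x y : β, x ≠ y ∧ S.neighborSet b = {x, y}) ∧
  (∀ u : α, Nonempty (Γ.neighborSet u ≃ S.neighborSet (f u))) ∧
  (∀ u v : α, Γ.Adj u v ↔ ∃ p : S.Walk (f u) (f v), p.IsPath ∧ 1 ≤ p.length ∧
      ∀ w ∈ p.support, w ∈ Set.range f → w = f u ∨ w = f v) ∧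
  (∀ e ∈ S.edgeSet, ∃ (u v : α) (p : S.Walk (f u) (f v)), Γ.Adj u v ∧ p.IsPath ∧
      (∀ w ∈ p.support, w ∈ Set.range f → w = f u ∨ w = f v) ∧ e ∈ p.edges)

/-- `S` is (isomorphic to) a subdivision of `Γ`. -/
def IsSubdivision (S : SimpleGraph β) (Γ : SimpleGraph α) : Prop :=
  ∃ f : α → β, SubdivVia f S Γ

end Subdiv

end SSRN

namespace SSRN

section HF
variable {G : Type*} [Group G]

lemma HFin.mono {H : Subgroup G} {X X' : Set G} (h : HFin H X) (hs : X' ⊆ X) : HFin H X' := by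
  obtain ⟨F, hF⟩ := h
  exact ⟨F, hs.trans hF⟩

lemma hfin_iff {H : Subgroup G} {X : Set G} :
    HFin H X ↔ ∃ F : Finset G, ∀ x ∈ X, ∃ f ∈ F, ∃ h ∈ H, h * f = x := by
  constructor
  · rintro ⟨F, hF⟩
    refine ⟨F, fun x hx => ?_⟩
    have := hF hx
    simp only [Set.mem_iUnion, Set.mem_image, SetLike.mem_coe] at this
    obtain ⟨f, hf, h, hh, e⟩ := this
    exact ⟨f, hf, h, hh, e⟩
  · rintro ⟨F, hF⟩
    refine ⟨F, fun x hx => ?_⟩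
    obtain ⟨f, hf, h, hh, e⟩ := hF x hx
    simp only [Set.mem_iUnion, Set.mem_image, SetLike.mem_coe]
    exact ⟨f, hf, h, hh, e⟩

lemma hfin_of_relIndex {K L : Subgroup G} (h : L.relIndex K ≠ 0) : HFin L (K : Set G) := by
  classical
  rw [hfin_iff]
  have hfi : (L.subgroupOf K).FiniteIndex := ⟨h⟩
  have hfin : Finite (K ⧸ L.subgroupOf K) := inferInstance
  have := Fintype.ofFinite (K ⧸ L.subgroupOf K)
  refine ⟨Finset.univ.image (fun q : K ⧸ L.subgroupOf K => ((q.out : K) : G)⁻¹), ?_⟩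
  intro k hk
  let k' : K := ⟨k, hk⟩
  let q : K ⧸ L.subgroupOf K := (k'⁻¹ : K)
  refine ⟨((q.out : K) : G)⁻¹, Finset.mem_image.2 ⟨q, Finset.mem_univ _, rfl⟩,
    k * ((q.out : K) : G), ?_, by group⟩
  have h1 : ((q.out : K) : K ⧸ L.subgroupOf K) = (k'⁻¹ : K) := q.out_eq'
  have h2 := QuotientGroup.eq.1 h1.symm
  rw [Subgroup.mem_subgroupOf] at h2
  simpa [k'] using h2

lemma HFin.of_comm {K L : Subgroup G} {X : Set G} (h : HFin K X)
    (hc : Subgroup.Commensurable K L) : HFin L X := by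
  classical
  obtain ⟨F, hF⟩ := hfin_iff.1 h
  obtain ⟨F', hF'⟩ := hfin_iff.1 (hfin_of_relIndex hc.2)
  refine hfin_iff.2 ⟨(F' ×ˢ F).image (fun p => p.1 * p.2), fun x hx => ?_⟩
  obtain ⟨f, hf, k, hk, rfl⟩ := hF x hx
  obtain ⟨f', hf', l, hl, rfl⟩ := hF' k hk
  exact ⟨f' * f, Finset.mem_image.2 ⟨(f', f), Finset.mem_product.2 ⟨hf', hf⟩, rfl⟩, l, hl,
    by group⟩

lemma comm_of_between {E : Set (Subgroup G)} (hE : Admissible E) {A B C : Subgroup G}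
    (hA : A ∈ E) (hC : C ∈ E) (hAB : Subgroup.Commensurable A B) (h : A ⊓ B ≤ C) :
    Subgroup.Commensurable A C := by
  have h1 : Subgroup.Commensurable (A ⊓ B) A := by
    refine ⟨?_, ?_⟩
    · rw [Subgroup.inf_relIndex_left]; exact hAB.2
    · rw [Subgroup.relIndex_eq_one.2 inf_le_left]; exact one_ne_zero
  have h2 : A ⊓ B ∈ E := hE.2.1 A hA _ h1
  have h3 : Subgroup.Commensurable (A ⊓ B) C := by
    refine ⟨hE.2.2 _ h2 _ hC h, ?_⟩
    rw [Subgroup.relIndex_eq_one.2 h]; exact one_ne_zero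
  exact h1.symm.trans h3

end HF

section TR
variable {G V : Type*} [Group G] [MulAction G V] {T : SimpleGraph V}

lemma mem_edgeStab {g : G} {u v : V} :
    g ∈ edgeStab G s(u, v) ↔ s(g • u, g • v) = s(u, v) := Iff.rfl

lemma mem_edgeStab_iff (hinv : NoInversions T G) {g : G} {u v : V} (h : T.Adj u v) :
    g ∈ edgeStab G s(u, v) ↔ g • u = u ∧ g • v = v := by
  rw [mem_edgeStab, Sym2.eq_iff]
  constructor
  · rintro (h1 | h1)
    · exact h1
    · exact absurd h1 (hinv g u v h)
  · exact Or.inl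

/-- The automorphism of `T` given by `g`. -/
def actHom (hact : ActsOn T G) (g : G) : T →g T where
  toFun := (g • ·)
  map_rel' := fun {a b} h => hact g a b h

lemma map_walk (hact : ActsOn T G) (g : G) {x y x' y' : V} (p : T.Walk x y)
    (hx : g • x = x') (hy : g • y = y') : ∃ q : T.Walk x' y', (p.IsPath → q.IsPath) ∧
      q.support = p.support.map (g • ·) ∧ q.edges = p.edges.map (Sym2.map (g • ·)) := by
  subst hx hy
  have hinj : Function.Injective (actHom hact g) := MulAction.injective g
  exact ⟨p.map (actHom hact g), fun hp => SimpleGraph.Walk.IsPath.map hinj hp,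
    SimpleGraph.Walk.support_map _ _, SimpleGraph.Walk.edges_map _ _⟩

lemma fix_path (hT : T.IsTree) (hact : ActsOn T G) {g : G} {x y : V} (p : T.Walk x y)
    (hp : p.IsPath) (hx : g • x = x) (hy : g • y = y) : ∀ w ∈ p.support, g • w = w := by
  obtain ⟨q, hq, hqs, _⟩ := map_walk hact g p hx hy
  have heq := (hT.existsUnique_path x y).unique (hq hp) hp
  have hs : p.support.map (g • ·) = p.support := by
    rw [← hqs, heq]
  intro w hw
  have : ∀ l : List V, l.map (g • ·) = l → ∀ w ∈ l, g • w = w := by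
    intro l
    induction l with
    | nil => simp
    | cons a l ih =>
      intro h w hw
      simp only [List.map_cons, List.cons.injEq] at h
      rcases List.mem_cons.1 hw with rfl | hw
      · exact h.1
      · exact ih h.2 w hw
  exact this _ hs w hw

lemma dist_smul (hT : T.IsTree) (hact : ActsOn T G) (g : G) (x y : V) :
    T.dist (g • x) (g • y) = T.dist x y := by
  have key : ∀ (g : G) (x y : V), T.dist (g • x) (g • y) ≤ T.dist x y := by
    intro g x y
    obtain ⟨p, hp⟩ := (hT.connected x y).exists_walk_length_eq_dist
    have := SimpleGraph.dist_le (p.map (actHom hact g))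
    rw [SimpleGraph.Walk.length_map, hp] at this
    exact this
  apply le_antisymm (key g x y)
  have := key g⁻¹ (g • x) (g • y)
  simpa using this

/-- Membership is constant along walks avoiding the coboundary. -/
lemma mem_of_walk {S : Set V} {a b : V} (p : T.Walk a b) (hp : ∀ e ∈ p.edges, e ∉ cobdry T S) :
    a ∈ S ↔ b ∈ S := by
  induction p with
  | nil => rfl
  | @cons a c b h q ih =>
    have h1 := ih (fun e he => hp e (by simp [he]))
    rw [← h1]
    have h2 := hp s(a, c) (by simp)
    constructor
    · intro ha
      by_contra hc
      exact h2 ⟨h, a, c, rfl, ha, hc⟩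
    · intro hc
      by_contra ha
      exact h2 ⟨h, c, a, Sym2.eq_swap, hc, ha⟩

/-- Half-tree. -/
def hz (T : SimpleGraph V) (u v : V) : Set V := {w | ∃ p : T.Walk v w, s(u, v) ∉ p.edges}

lemma self_mem_hz (u v : V) : v ∈ hz T u v := ⟨.nil, by simp⟩

lemma bridge (hT : T.IsTree) {u v : V} (h : T.Adj u v) (p : T.Walk u v) : s(u, v) ∈ p.edges :=
  SimpleGraph.isBridge_iff_forall_walk_mem_edges.1
    (SimpleGraph.isAcyclic_iff_forall_adj_isBridge.1 hT.isAcyclic h) p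

lemma hz_disj (hT : T.IsTree) {u v w : V} (h : T.Adj u v) (h1 : w ∈ hz T u v)
    (h2 : w ∈ hz T v u) : False := by
  obtain ⟨p, hp⟩ := h1
  obtain ⟨q, hq⟩ := h2
  have := bridge hT h (q.append p.reverse)
  rw [SimpleGraph.Walk.edges_append, SimpleGraph.Walk.edges_reverse, List.mem_append,
    List.mem_reverse] at this
  rcases this with h | h
  · exact hq (by rwa [Sym2.eq_swap])
  · exact hp h

lemma hz_trans {u v w x : V} (h : w ∈ hz T u v) (p : T.Walk w x) (hp : s(u, v) ∉ p.edges) :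
    x ∈ hz T u v := by
  obtain ⟨q, hq⟩ := h
  exact ⟨q.append p, by simp [hq, hp]⟩

lemma hz_cover (hT : T.IsTree) {u v : V} (w : V) : w ∈ hz T u v ∨ w ∈ hz T v u := by
  obtain ⟨p⟩ := hT.connected w v
  induction p with
  | nil => exact Or.inl (self_mem_hz _ _)
  | @cons a b v h q ih =>
    by_cases he : s(u, v) = s(b, a)
    · rcases Sym2.eq_iff.1 he with ⟨rfl, rfl⟩ | ⟨rfl, rfl⟩
      · exact Or.inl (self_mem_hz _ _)
      · exact Or.inr (self_mem_hz _ _)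
    · rcases ih with h1 | h1
      · exact Or.inl (hz_trans h1 (.cons h.symm .nil) (by simpa using he))
      · exact Or.inr (hz_trans h1 (.cons h.symm .nil) (by rw [Sym2.eq_swap]; simpa using he))

lemma hz_support {u v w : V} (p : T.Walk v w) (hp : s(u, v) ∉ p.edges) :
    ∀ x ∈ p.support, x ∈ hz T u v := by
  classical
  intro x hx
  exact ⟨p.takeUntil x hx, fun h => hp (p.edges_takeUntil_subset_edges hx h)⟩

lemma hz_convex {u v a b w : V} (ha : a ∈ hz T u v) (hb : b ∈ hz T u v)
    (hw : Btw T a w b) : w ∈ hz T u v := by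
  classical
  obtain ⟨p, hp⟩ := ha
  obtain ⟨q, hq⟩ := hb
  let r := p.reverse.append q
  have hr : s(u, v) ∉ r.edges := by simp [r, hp, hq]
  have h1 := hw r.bypass r.bypass_isPath
  have h2 : s(u, v) ∉ r.bypass.edges := fun h => hr (r.edges_bypass_subset_edges h)
  exact hz_trans ⟨p, hp⟩ (r.bypass.takeUntil w h1)
    (fun h => h2 (SimpleGraph.Walk.edges_takeUntil_subset_edges _ _ h))

lemma hz_smul (hact : ActsOn T G) (g : G) {u v w : V} (h : w ∈ hz T u v) :
    g • w ∈ hz T (g • u) (g • v) := by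
  obtain ⟨p, hp⟩ := h
  obtain ⟨q, _, _, hq⟩ := map_walk hact g p rfl rfl
  refine ⟨q, ?_⟩
  rw [hq]
  intro hm
  obtain ⟨e, he, hee⟩ := List.mem_map.1 hm
  have : e = s(u, v) := Sym2.map.injective (MulAction.injective g) (hee.trans rfl)
  exact hp (this ▸ he)

lemma orbit_meets (hT : T.IsTree) (hact : ActsOn T G) (hmin : MinimalAction T G) {u v : V}
    (h : T.Adj u v) (x : V) : ∃ g : G, g • x ∈ hz T u v := by
  by_contra hno
  push Not at hno
  have := hmin {w | ∀ g : G, g • w ∉ hz T u v} ⟨x, hno⟩ ?_ ?_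
  · have h1 : v ∈ {w | ∀ g : G, g • w ∉ hz T u v} := this ▸ Set.mem_univ v
    exact h1 1 (by simpa using self_mem_hz u v)
  · intro g a ha g'
    rw [← mul_smul]
    exact ha _
  · intro a ha b hb w hw g hg
    have ha' := (hz_cover hT (g • a)).resolve_left (ha g)
    have hb' := (hz_cover hT (g • b)).resolve_left (hb g)
    refine hz_disj hT h hg (hz_convex ha' hb' ?_)
    intro p hp
    obtain ⟨q, hq, hqs, _⟩ := map_walk hact g⁻¹ p (inv_smul_smul g a) (inv_smul_smul g b)
    have h3 := hw q (hq hp)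
    rw [hqs] at h3
    obtain ⟨y, hy, hyw⟩ := List.mem_map.1 h3
    have : g • w = y := by rw [← hyw]; exact smul_inv_smul g y
    rwa [this]

lemma no_leaf (hT : T.IsTree) (hact : ActsOn T G) (hinv : NoInversions T G)
    (hmin : MinimalAction T G) {u v : V} (h : T.Adj u v) : ∃ w, T.Adj v w ∧ w ≠ u := by
  by_contra hno
  push Not at hno
  have hsub : ∀ w ∈ hz T u v, w = v := by
    rintro w ⟨p, hp⟩
    cases p with
    | nil => rfl
    | @cons _ b _ h' q =>
      have := hno b h'
      subst this
      exact absurd (by simp [Sym2.eq_swap]) hp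
  obtain ⟨g, hg⟩ := orbit_meets hT hact hmin h u
  have hgu := hsub _ hg
  have h1 := hact g u v h
  rw [hgu] at h1
  exact hinv g u v h ⟨hgu, hno _ h1⟩

lemma dist_hz (hT : T.IsTree) {u v y : V} (h : T.Adj u v) (hy : y ∈ hz T u v) :
    T.dist v y + 1 ≤ T.dist u y := by
  classical
  obtain ⟨p, hp⟩ := (hT.connected u y).exists_walk_length_eq_dist
  have he : s(u, v) ∈ p.edges := by
    by_contra hne
    exact hz_disj hT h hy ⟨p, by rwa [Sym2.eq_swap]⟩
  have hv : v ∈ p.support := p.snd_mem_support_of_mem_edges he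
  have h1 := congrArg SimpleGraph.Walk.length (p.take_spec hv)
  rw [SimpleGraph.Walk.length_append] at h1
  have h2 := SimpleGraph.dist_le (p.dropUntil v hv)
  have h3 : (p.takeUntil v hv).length ≠ 0 := fun h0 =>
    h.ne (SimpleGraph.Walk.eq_of_length_eq_zero h0)
  omega

lemma hz_far (hT : T.IsTree) (hact : ActsOn T G) (hinv : NoInversions T G)
    (hmin : MinimalAction T G) (x : V) (n : ℕ) :
    ∀ u v : V, T.Adj u v → ∃ g : G, g • x ∈ hz T u v ∧ n ≤ T.dist u (g • x) := by
  induction n with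
  | zero =>
    intro u v h
    obtain ⟨g, hg⟩ := orbit_meets hT hact hmin h x
    exact ⟨g, hg, Nat.zero_le _⟩
  | succ n ih =>
    intro u v h
    obtain ⟨w, hw, hwu⟩ := no_leaf hT hact hinv hmin h
    obtain ⟨g, hg, hn⟩ := ih v w hw
    have hg' : g • x ∈ hz T u v := by
      obtain ⟨p, hp⟩ := hg
      refine ⟨.cons hw p, ?_⟩
      rw [SimpleGraph.Walk.edges_cons, List.mem_cons]
      rintro (h1 | h1)
      · rcases Sym2.eq_iff.1 h1 with ⟨rfl, rfl⟩ | ⟨rfl, _⟩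
        · exact hwu rfl
        · exact hwu rfl
      · have hv := p.snd_mem_support_of_mem_edges h1
        exact hz_disj hT hw (hz_support p hp v hv) (self_mem_hz _ _)
    exact ⟨g, hg', by have := dist_hz hT h hg'; omega⟩

lemma finite_of_no_hz (hT : T.IsTree) {F : Set V} (hF : (cobdry T F).Finite)
    (hno : ∀ u v, T.Adj u v → ¬ hz T u v ⊆ F) (r : V) : F.Finite := by
  classical
  choose P hP using fun x : V => (hT.existsUnique_path r x).exists
  have hfin : ({r} ∪ ⋃ e ∈ cobdry T F, ⋃ x ∈ {x | x ∈ e}, {w | w ∈ (P x).support}).Finite := by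
    refine (Set.finite_singleton r).union (hF.biUnion fun e _ => Set.Finite.biUnion ?_ ?_)
    · induction e with
      | _ a b =>
        refine (Set.toFinite {a, b}).subset ?_
        intro x hx
        simpa using hx
    · intro x _
      exact List.finite_toSet _
  refine hfin.subset ?_
  intro w hw
  by_cases hwr : w = r
  · exact Or.inl hwr
  right
  obtain ⟨p, hp⟩ := (hT.existsUnique_path w r).exists
  cases p with
  | nil => exact absurd rfl hwr
  | @cons _ u _ h q =>
    rw [SimpleGraph.Walk.cons_isPath_iff] at hp
    have hr : r ∈ hz T w u := ⟨q, fun hm => hp.2 (q.fst_mem_support_of_mem_edges hm)⟩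
    have h' := h.symm
    obtain ⟨y, hy, hyF⟩ := Set.not_subset.1 (hno u w h')
    obtain ⟨p, hpp⟩ := hy
    have : ¬ ∀ e ∈ p.edges, e ∉ cobdry T F := fun hall => hyF ((mem_of_walk p hall).1 hw)
    push Not at this
    obtain ⟨e, he, heF⟩ := this
    induction e with
    | _ a b =>
      have ha : a ∈ hz T u w := hz_support p hpp a (p.fst_mem_support_of_mem_edges he)
      simp only [Set.mem_iUnion]
      refine ⟨s(a, b), heF, a, by simp, ?_⟩
      have : s(u, w) ∈ (P a).edges := by
        by_contra hne
        exact hz_disj hT h' ha (hz_trans hr (P a) (by rwa [Sym2.eq_swap]))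
      exact (P a).snd_mem_support_of_mem_edges this

/-- Forward direction. -/
lemma forward (hT : T.IsTree) (hact : ActsOn T G) (hinv : NoInversions T G)
    (hmin : MinimalAction T G) (v₀ : V) {F : Set V} (hF : (cobdry T F).Finite)
    {a b : V} (hab : T.Adj a b) (h : HFin (edgeStab G s(a, b)) (XS G v₀ F)) : F.Finite := by
  obtain ⟨A, hA⟩ := hfin_iff.1 h
  refine finite_of_no_hz hT hF ?_ v₀
  intro u v huv hsub
  obtain ⟨g, hg, hd⟩ := hz_far hT hact hinv hmin v₀
    (T.dist u a + (∑ f ∈ A, T.dist a (f • v₀)) + 1) u v huv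
  obtain ⟨f, hf, k, hk, rfl⟩ := hA g (hsub hg)
  have hka := ((mem_edgeStab_iff hinv hab).1 hk).1
  have h1 : T.dist a ((k * f) • v₀) = T.dist a (f • v₀) := by
    conv_lhs => rw [← hka, mul_smul]
    exact dist_smul hT hact k _ _
  have h2 : T.dist a (f • v₀) ≤ ∑ f ∈ A, T.dist a (f • v₀) :=
    Finset.single_le_sum (f := fun f => T.dist a (f • v₀)) (fun _ _ => Nat.zero_le _) hf
  have h3 := hT.connected.dist_triangle (u := u) (v := a) (w := (k * f) • v₀)
  omega


lemma comm_vertex (hact : ActsOn T G) (hinv : NoInversions T G) {v u : V} (h : T.Adj v u)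
    (hfin : (T.neighborSet v).Finite) :
    Subgroup.Commensurable (MulAction.stabilizer G v) (edgeStab G s(v, u)) := by
  have hle : edgeStab G s(v, u) ≤ MulAction.stabilizer G v := fun g hg =>
    ((mem_edgeStab_iff hinv h).1 hg).1
  refine ⟨by rw [Subgroup.relIndex_eq_one.2 hle]; exact one_ne_zero, ?_⟩
  have heq : (edgeStab G s(v, u)).subgroupOf (MulAction.stabilizer G v) =
      MulAction.stabilizer (MulAction.stabilizer G v) u := by
    ext g
    rw [Subgroup.mem_subgroupOf, mem_edgeStab_iff hinv h]
    exact ⟨fun h => h.2, fun h => ⟨g.2, h⟩⟩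
  rw [Subgroup.relIndex, heq, MulAction.index_stabilizer]
  have hsub : MulAction.orbit (MulAction.stabilizer G v) u ⊆ T.neighborSet v := by
    rintro _ ⟨g, rfl⟩
    have := hact g v u h
    rwa [g.2] at this
  have hne : (MulAction.orbit (MulAction.stabilizer G v) u).Nonempty :=
    ⟨u, MulAction.mem_orbit_self u⟩
  exact (Set.ncard_pos (hfin.subset hsub)).2 hne |>.ne'

lemma finite_nbr {S S' : Set V} (hS : (cobdry T S).Finite) (hS' : (cobdry T S').Finite)
    (hF : (S ∩ S').Finite) {v : V} (hv : v ∈ S ∩ S') : (T.neighborSet v).Finite := by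
  have h1 : ((fun u => s(v, u)) ⁻¹' (cobdry T S ∪ cobdry T S')).Finite := by
    refine (hS.union hS').preimage ?_
    intro a _ b _ hab
    exact Sym2.congr_right.1 hab
  refine (hF.union h1).subset ?_
  intro u hu
  by_cases hu1 : u ∈ S
  · by_cases hu2 : u ∈ S'
    · exact Or.inl ⟨hu1, hu2⟩
    · exact Or.inr (Or.inr ⟨hu, v, u, rfl, hv.2, hu2⟩)
  · exact Or.inr (Or.inl ⟨hu, v, u, rfl, hv.1, hu1⟩)

lemma comm_or (hact : ActsOn T G) (hinv : NoInversions T G) {S S' : Set V} {H H' : Subgroup G}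
    (hH : ∀ e ∈ cobdry T S, Subgroup.Commensurable H (edgeStab G e))
    (hH' : ∀ e ∈ cobdry T S', Subgroup.Commensurable H' (edgeStab G e))
    (hnbr : ∀ v ∈ S ∩ S', (T.neighborSet v).Finite) {v u : V} (p : T.Walk v u)
    (hv : v ∈ S ∩ S') (hu : u ∉ S ∩ S') :
    Subgroup.Commensurable (MulAction.stabilizer G v) H ∨
      Subgroup.Commensurable (MulAction.stabilizer G v) H' := by
  induction p with
  | nil => exact absurd hv hu
  | @cons v w u h q ih =>
    have hc := comm_vertex hact hinv h (hnbr v hv)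
    by_cases hw1 : w ∈ S
    · by_cases hw2 : w ∈ S'
      · have hc' := comm_vertex hact hinv h.symm (hnbr w ⟨hw1, hw2⟩)
        rw [Sym2.eq_swap] at hc'
        have hvw := hc.trans hc'.symm
        exact (ih ⟨hw1, hw2⟩ hu).imp hvw.trans hvw.trans
      · exact Or.inr (hc.trans (hH' _ ⟨h, v, w, rfl, hv.2, hw2⟩).symm)
    · exact Or.inl (hc.trans (hH _ ⟨h, v, w, rfl, hv.1, hw1⟩).symm)

lemma path_contra (hT : T.IsTree) (hact : ActsOn T G) (hinv : NoInversions T G)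
    {E : Set (Subgroup G)} (hE : Admissible E) (hET : IsETree T G E)
    {S S' : Set V} {H H' : Subgroup G}
    (hH : ∀ e ∈ cobdry T S, Subgroup.Commensurable H (edgeStab G e))
    (hH' : ∀ e ∈ cobdry T S', Subgroup.Commensurable H' (edgeStab G e))
    (hnbr : ∀ v ∈ S ∩ S', (T.neighborSet v).Finite)
    (hHH : ¬ Subgroup.Commensurable H H') {z w : V} (q : T.Walk z w) :
    ∀ (z₀ : V) (h : T.Adj z₀ z), (SimpleGraph.Walk.cons h q).IsPath → z ∈ S' → w ∈ S ∩ S' →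
      Subgroup.Commensurable H (edgeStab G s(z₀, z)) →
      Subgroup.Commensurable (MulAction.stabilizer G w) H' → False := by
  classical
  induction q with
  | nil =>
    intro z₀ h _ _ hw h1 h2
    have := comm_vertex hact hinv h.symm (hnbr _ hw)
    rw [Sym2.eq_swap] at this
    exact hHH (h1.trans (this.symm.trans h2))
  | @cons z z' w f q ih =>
    intro z₀ h hp hz hw h1 h2
    by_cases hf : Subgroup.Commensurable H (edgeStab G s(z, z'))
    · refine ih z f hp.of_cons ?_ hw hf h2
      by_contra hz'
      exact hHH (hf.trans (hH' _ ⟨f, z, z', rfl, hz, hz'⟩).symm)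
    · have hno : ∀ e ∈ (SimpleGraph.Walk.cons f q).edges, e ∉ cobdry T S := by
        intro e he hcob
        have hce := hH e hcob
        rw [SimpleGraph.Walk.edges_cons, List.mem_cons] at he
        rcases he with rfl | he
        · exact hf hce
        apply hf
        refine h1.trans (comm_of_between hE (hET _ h) (hET _ f) (h1.symm.trans hce) ?_)
        rintro g ⟨hg1, hg2⟩
        induction e with
        | _ a b =>
          have ha := q.fst_mem_support_of_mem_edges he
          have hab : T.Adj a b := hcob.1
          have hga := ((mem_edgeStab_iff hinv hab).1 hg2).1
          have hgz := ((mem_edgeStab_iff hinv h).1 hg1).2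
          have hp' : (SimpleGraph.Walk.cons f (q.takeUntil a ha)).IsPath := by
            have := hp.of_cons
            rw [SimpleGraph.Walk.cons_isPath_iff] at this ⊢
            exact ⟨this.1.takeUntil ha, fun hm =>
              this.2 (SimpleGraph.Walk.support_takeUntil_subset_support _ ha hm)⟩
          have hfix := fix_path hT hact _ hp' hgz hga
          exact (mem_edgeStab_iff hinv f).2 ⟨hgz, hfix z' (by simp)⟩
      have hzS : z ∈ S := (mem_of_walk _ hno).2 hw.1
      have hn := hnbr z ⟨hzS, hz⟩
      have c1 := comm_vertex hact hinv h.symm hn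
      rw [Sym2.eq_swap] at c1
      exact hf (h1.trans (c1.symm.trans (comm_vertex hact hinv f hn)))

lemma hfin_of_all {F : Set V} (hF : F.Finite) (v₀ : V) {H : Subgroup G}
    (h : ∀ v ∈ F, Subgroup.Commensurable (MulAction.stabilizer G v) H) :
    HFin H (XS G v₀ F) := by
  classical
  have h1 : ∀ v ∈ F, HFin H {g : G | g • v₀ = v} := by
    intro v hv
    refine HFin.of_comm ?_ (h v hv)
    by_cases hne : ∃ g : G, g • v₀ = v
    · obtain ⟨g, hg⟩ := hne
      refine hfin_iff.2 ⟨{g}, fun x hx => ⟨g, by simp, x * g⁻¹, ?_, by group⟩⟩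
      rw [MulAction.mem_stabilizer_iff, ← hg, mul_smul, inv_smul_smul, hg]
      exact hx
    · exact hfin_iff.2 ⟨∅, fun x hx => absurd ⟨x, hx⟩ hne⟩
  choose! A hA using fun v hv => hfin_iff.1 (h1 v hv)
  refine hfin_iff.2 ⟨hF.toFinset.biUnion A, fun x hx => ?_⟩
  obtain ⟨f, hf, k, hk, e⟩ := hA (x • v₀) hx x rfl
  exact ⟨f, Finset.mem_biUnion.2 ⟨x • v₀, hF.mem_toFinset.2 hx, hf⟩, k, hk, e⟩

end TR


/-- `X_S ∩ X_{S'}` is small (finite over the group over which it is almost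
invariant, a group in the commensurability class of the base cylinder) if and only if
`S ∩ S'` is finite. -/
theorem stmt_6 {G V : Type*} [Group G] [MulAction G V]
    (hGfg : Group.FG G)
    (T : SimpleGraph V) (hT : T.IsTree) (hact : ActsOn T G) (hinv : NoInversions T G)
    (E : Set (Subgroup G)) (hE : Admissible E) (hET : IsETree T G E)
    (hmin : MinimalAction T G) (v₀ : V)
    (Y Y' : Set (Sym2 V)) (hY : IsCylinder T G Y) (hY' : IsCylinder T G Y')
    (S S' : Set V) (hS : IsSpecialForest T S Y) (hS' : IsSpecialForest T S' Y')
    (hHS : InClassOf G Y (⨅ e ∈ cobdry T S, edgeStab G e))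
    (hHS' : InClassOf G Y' (⨅ e ∈ cobdry T S', edgeStab G e)) :
    (HFin (⨅ e ∈ cobdry T S, edgeStab G e) (XS G v₀ S ∩ XS G v₀ S') ∨
      HFin (⨅ e ∈ cobdry T S', edgeStab G e) (XS G v₀ S ∩ XS G v₀ S')) ↔
      (S ∩ S').Finite := by
  have hcob : cobdry T (S ∩ S') ⊆ cobdry T S ∪ cobdry T S' := by
    rintro e ⟨he, u, v, rfl, hu, hv⟩
    by_cases h1 : v ∈ S
    · exact Or.inr ⟨he, u, v, rfl, hu.2, fun h2 => hv ⟨h1, h2⟩⟩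
    · exact Or.inl ⟨he, u, v, rfl, hu.1, h1⟩
  have hcobf : (cobdry T (S ∩ S')).Finite := (hS.1.union hS'.1).subset hcob
  have hXX : XS G v₀ S ∩ XS G v₀ S' = XS G v₀ (S ∩ S') := rfl
  rw [hXX]
  have fwd : ∀ (Z : Set (Sym2 V)) (K : Subgroup G), IsCylinder T G Z → InClassOf G Z K →
      HFin K (XS G v₀ (S ∩ S')) → (S ∩ S').Finite := by
    rintro Z K hZ ⟨e, he, hc⟩ hK
    have he' := hZ.2.1 he
    induction e with
    | _ a b => exact forward hT hact hinv hmin v₀ hcobf he' (hK.of_comm hc)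
  constructor
  · rintro (h | h)
    · exact fwd Y _ hY hHS h
    · exact fwd Y' _ hY' hHS' h
  intro hF
  have gen : ∀ (Z : Set (Sym2 V)) (K : Subgroup G) (R : Set V), IsCylinder T G Z →
      InClassOf G Z K → IsSpecialForest T R Z →
      ∀ e ∈ cobdry T R, Subgroup.Commensurable K (edgeStab G e) := by
    rintro Z K R hZ ⟨e₀, he₀, hc⟩ hR e he
    exact hc.trans ((hZ.2.2 e₀ he₀ e he.1).1 (hR.2 he))
  have hH := gen Y _ S hY hHS hS
  have hH' := gen Y' _ S' hY' hHS' hS'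
  have hnbr : ∀ v ∈ S ∩ S', (T.neighborSet v).Finite :=
    fun v hv => finite_nbr hS.1 hS'.1 hF hv
  by_cases hall : ∀ u, u ∈ S ∩ S'
  · left
    have hemp : cobdry T S = ∅ := by
      ext e
      constructor
      · rintro ⟨_, u, v, _, _, hv⟩
        exact absurd (hall v).1 hv
      · intro h; exact absurd h (Set.notMem_empty _)
    refine hfin_iff.2 ⟨{1}, fun x _ => ⟨1, by simp, x, ?_, by simp⟩⟩
    rw [hemp]
    simp
  push Not at hall
  obtain ⟨u, hu⟩ := hall
  have hor := fun v (hv : v ∈ S ∩ S') =>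
    comm_or hact hinv hH hH' hnbr (hT.connected v u).some hv hu
  by_contra hno
  push Not at hno
  have h1 : ∃ w ∈ S ∩ S', ¬ Subgroup.Commensurable (MulAction.stabilizer G w)
      (⨅ e ∈ cobdry T S, edgeStab G e) := by
    by_contra hcon
    push Not at hcon
    exact hno.1 (hfin_of_all hF v₀ hcon)
  have h2 : ∃ w ∈ S ∩ S', ¬ Subgroup.Commensurable (MulAction.stabilizer G w)
      (⨅ e ∈ cobdry T S', edgeStab G e) := by
    by_contra hcon
    push Not at hcon
    exact hno.2 (hfin_of_all hF v₀ hcon)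
  obtain ⟨w, hw, hwn⟩ := h1
  obtain ⟨v, hv, hvn⟩ := h2
  have hwc := (hor w hw).resolve_left hwn
  have hvc := (hor v hv).resolve_right hvn
  have hHH : ¬ Subgroup.Commensurable (⨅ e ∈ cobdry T S, edgeStab G e)
      (⨅ e ∈ cobdry T S', edgeStab G e) := fun h => hvn (hvc.trans h)
  obtain ⟨p, hp⟩ := (hT.existsUnique_path v w).exists
  cases p with
  | nil => exact hwn hvc
  | @cons _ z _ h q =>
    have c1 := hvc.symm.trans (comm_vertex hact hinv h (hnbr v hv))
    refine path_contra hT hact hinv hE hET hH hH' hnbr hHH q v h hp ?_ hw c1 hwc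
    by_contra hz
    exact hHH (c1.trans (hH' _ ⟨h, v, z, rfl, hv.2, hz⟩).symm)

end SSRN
end

section
/- Let G be a finitely generated group, E an admissible family of subgroups of G, and T a minimal E-tree in which every vertex has valence at least 3. Let S be an infinite connected non-peripheral special forest based on a cylinder Y. Then there is an edge e contained in S ∩ Y such that both connected components of S minus the open edge e are infinite. -/
open scoped Pointwise symmDiff

namespace SSRN

section Aux
variable {V : Type*} {T : SimpleGraph V}

/-- In a tree, a vertex has at most one neighbour closer to a given vertex. -/
lemma aux_closer_unique (hT : T.IsTree) {r x a b : V} (ha : T.Adj x a) (hb : T.Adj x b)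
    (hda : T.dist r x = T.dist r a + 1) (hdb : T.dist r x = T.dist r b + 1) : a = b := by
  obtain ⟨p, hp⟩ := hT.connected.exists_walk_length_eq_dist r a
  obtain ⟨q, hq⟩ := hT.connected.exists_walk_length_eq_dist r b
  have h1 : (p.concat ha.symm).IsPath :=
    SimpleGraph.Walk.isPath_of_length_eq_dist _ (by simp [hp, hda])
  have h2 : (q.concat hb.symm).IsPath :=
    SimpleGraph.Walk.isPath_of_length_eq_dist _ (by simp [hq, hdb])
  have h3 := (hT.existsUnique_path r x).unique h1 h2
  have := congrArg SimpleGraph.Walk.penultimate h3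
  simpa using this

lemma aux_path_length (hT : T.IsTree) {a b : V} (p : T.Walk a b) (hp : p.IsPath) :
    p.length = T.dist a b := by
  obtain ⟨q, hq, hl⟩ := hT.connected.exists_path_of_dist a b
  rw [(hT.existsUnique_path a b).unique hp hq, hl]

/-- the `u`-side of `S` with respect to the edge `uw`. -/
def auxC (T : SimpleGraph V) (S : Set V) (u w : V) : Set V :=
  {x | x ∈ S ∧ T.dist x w = T.dist x u + 1}

/-- inner endpoints of the coboundary. -/
def auxD (T : SimpleGraph V) (S : Set V) : Set V :=
  {x | x ∈ S ∧ ∃ z, T.Adj x z ∧ z ∉ S}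

lemma auxD_finite {S : Set V} (h : (cobdry T S).Finite) : (auxD T S).Finite := by
  have : (⋃ e ∈ cobdry T S, {x : V | x ∈ e}).Finite := by
    refine h.biUnion fun e _ => ?_
    induction e using Sym2.ind with
    | _ a b =>
      refine (Set.toFinite {a, b}).subset ?_
      intro x hx
      simpa using hx
  refine this.subset ?_
  rintro x ⟨hx, z, hz, hzS⟩
  simp only [Set.mem_iUnion]
  exact ⟨s(x, z), ⟨hz, x, z, rfl, hx, hzS⟩, by simp⟩

lemma aux_exists_D (hT : T.IsTree)
    (hval3 : ∀ w : V, ∃ a b c : V, a ≠ b ∧ a ≠ c ∧ b ≠ c ∧ T.Adj w a ∧ T.Adj w b ∧ T.Adj w c)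
    {S : Set V} {u w : V} (huw : T.Adj u w) (hu : u ∈ S) (hf : (auxC T S u w).Finite) :
    (auxD T S ∩ auxC T S u w).Nonempty := by
  have hne : (auxC T S u w).Nonempty :=
    ⟨u, hu, by simp [SimpleGraph.dist_eq_one_iff_adj.2 huw]⟩
  obtain ⟨x, hx, hmax⟩ := hf.exists_maximalFor (fun x => T.dist w x) _ hne
  have hz : ∃ z, T.Adj x z ∧ T.dist w z = T.dist w x + 1 := by
    obtain ⟨a, b, _, hab, _, _, ha, hb, _⟩ := hval3 x
    rcases hT.dist_eq_dist_add_one_of_adj w ha with h1 | h1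
    · rcases hT.dist_eq_dist_add_one_of_adj w hb with h2 | h2
      · exact absurd (aux_closer_unique hT ha hb h1 h2) hab
      · exact ⟨b, hb, h2⟩
    · exact ⟨a, ha, h1⟩
  obtain ⟨z, hxz, hzd⟩ := hz
  refine ⟨x, ⟨hx.1, z, hxz, fun hzS => ?_⟩, hx⟩
  have hzC : z ∈ auxC T S u w := by
    refine ⟨hzS, ?_⟩
    have h1 := hx.2
    have h2 := hT.connected.dist_triangle (u := z) (v := x) (w := u)
    have h3 := hT.connected.dist_triangle (u := z) (v := u) (w := w)
    have h4 := SimpleGraph.dist_eq_one_iff_adj.2 hxz.symm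
    have h5 := SimpleGraph.dist_eq_one_iff_adj.2 huw
    rw [T.dist_comm (u := w) (v := z), T.dist_comm (u := w) (v := x)] at hzd
    omega
  have := hmax hzC
  simp only at this
  omega

lemma auxC_subset (hT : T.IsTree) {S : Set V} {u w z : V} (huw : T.Adj u w) (hwz : T.Adj w z)
    (hne : u ≠ z) : auxC T S u w ⊆ auxC T S w z := by
  rintro x ⟨hx, hd⟩
  refine ⟨hx, ?_⟩
  rcases hT.dist_eq_dist_add_one_of_adj x hwz with h | h
  · exact absurd (aux_closer_unique hT huw.symm hwz hd h) hne
  · exact h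

lemma aux_ssubset (hT : T.IsTree)
    (hval3 : ∀ w : V, ∃ a b c : V, a ≠ b ∧ a ≠ c ∧ b ≠ c ∧ T.Adj w a ∧ T.Adj w b ∧ T.Adj w c)
    {S : Set V} {u w z : V} (huw : T.Adj u w) (hwz : T.Adj w z) (hw : w ∈ S)
    (hne : u ≠ z) (hf : (auxC T S w z).Finite) :
    ∃ d ∈ auxD T S ∩ auxC T S w z, d ∉ auxC T S u w := by
  obtain ⟨y, hwy, hyu, hyz⟩ : ∃ y, T.Adj w y ∧ y ≠ u ∧ y ≠ z := by
    obtain ⟨a, b, c, hab, hac, hbc, ha, hb, hc⟩ := hval3 w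
    by_cases h1 : a ≠ u ∧ a ≠ z
    · exact ⟨a, ha, h1⟩
    by_cases h2 : b ≠ u ∧ b ≠ z
    · exact ⟨b, hb, h2⟩
    refine ⟨c, hc, ?_⟩
    grind
  by_cases hyS : y ∈ S
  · have hsub : auxC T S y w ⊆ auxC T S w z := auxC_subset hT hwy.symm hwz hyz
    obtain ⟨d, hdD, hdC⟩ := aux_exists_D hT hval3 hwy.symm hyS (hf.subset hsub)
    exact ⟨d, ⟨hdD, hsub hdC⟩,
      fun h => hyu (aux_closer_unique hT hwy huw.symm hdC.2 h.2)⟩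
  · refine ⟨w, ⟨⟨hw, y, hwy, hyS⟩, hw, ?_⟩, ?_⟩
    · simp [SimpleGraph.dist_eq_one_iff_adj.2 hwz]
    · rintro ⟨_, h⟩
      simp at h

lemma aux_convex (hT : T.IsTree) {S : Set V}
    (hconn : ∀ u ∈ S, ∀ w ∈ S, ∃ p : T.Walk u w, ∀ x ∈ p.support, x ∈ S)
    {a b : V} (ha : a ∈ S) (hb : b ∈ S) (p : T.Walk a b) (hp : p.IsPath) :
    ∀ x ∈ p.support, x ∈ S := by
  classical
  obtain ⟨q, hq⟩ := hconn a ha b hb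
  rw [(hT.existsUnique_path a b).unique hp q.bypass_isPath]
  exact fun x hx => hq x (q.support_bypass_subset_support hx)

/-- on the path `v, z, ..., x`, the vertex `x` is on the `z` side of `vz`. -/
lemma aux_cons_dist (hT : T.IsTree) {v z x : V} (h : T.Adj v z) (p : T.Walk z x)
    (hp : (SimpleGraph.Walk.cons h p).IsPath) : T.dist x v = T.dist x z + 1 := by
  have h1 := aux_path_length hT _ hp
  have h2 := aux_path_length hT p hp.of_cons
  rw [T.dist_comm (u := x) (v := v), T.dist_comm (u := x) (v := z), ← h1, ← h2]
  simp

/-- `auxC` is contained in the component in the statement. -/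
lemma auxC_subset_comp (hT : T.IsTree) {S : Set V}
    (hconn : ∀ u ∈ S, ∀ w ∈ S, ∃ p : T.Walk u w, ∀ x ∈ p.support, x ∈ S)
    {u w : V} (hu : u ∈ S) :
    auxC T S u w ⊆ {x : V | x ∈ S ∧ ∃ p : T.Walk u x, p.IsPath ∧ (∀ y ∈ p.support, y ∈ S) ∧
        s(u, w) ∉ p.edges} := by
  classical
  rintro x ⟨hx, hd⟩
  obtain ⟨p, hp, hl⟩ := hT.connected.exists_path_of_dist u x
  refine ⟨hx, p, hp, aux_convex hT hconn hu hx p hp, fun he => ?_⟩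
  have hw : w ∈ p.support := p.snd_mem_support_of_mem_edges he
  have h1 : T.dist w x ≤ (p.dropUntil w hw).length := SimpleGraph.dist_le _
  have h2 := p.length_dropUntil_le_length hw
  rw [T.dist_comm (u := x) (v := w), T.dist_comm (u := x) (v := u)] at hd
  omega

/-- a path starting at `v` containing an edge at `v` starts with that edge. -/
lemma aux_first_edge {v a x : V} (h : T.Adj v a) (p : T.Walk a x)
    (hp : (SimpleGraph.Walk.cons h p).IsPath) {e : Sym2 V} (hv : v ∈ e)
    (he : e ∈ (SimpleGraph.Walk.cons h p).edges) : e = s(v, a) := by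
  rw [SimpleGraph.Walk.edges_cons, List.mem_cons] at he
  rcases he with he | he
  · exact he
  · obtain ⟨b, rfl⟩ := Sym2.mem_iff_exists.1 hv
    have := p.fst_mem_support_of_mem_edges he
    rw [SimpleGraph.Walk.cons_isPath_iff] at hp
    exact absurd this hp.2

end Aux

section AuxG
variable {G V : Type*} [Group G] [MulAction G V] {T : SimpleGraph V}

lemma aux_edge_fix (hinv : NoInversions T G) {a b : V} (hab : T.Adj a b) {g : G}
    (hg : g ∈ edgeStab G s(a, b)) : g • a = a ∧ g • b = b := by
  have h : Sym2.map (g • ·) s(a, b) = s(a, b) := hg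
  rw [Sym2.map_mk, Sym2.eq_iff] at h
  rcases h with h | h
  · exact h
  · exact absurd h (hinv g a b hab)

lemma aux_path_fix (hT : T.IsTree) (hact : ActsOn T G) {g : G} {a b : V} (ha : g • a = a)
    (hb : g • b = b) (p : T.Walk a b) (hp : p.IsPath) : ∀ x ∈ p.support, g • x = x := by
  let f : T →g T := ⟨fun x => g • x, fun h => hact g _ _ h⟩
  have hf : Function.Injective f := MulAction.injective g
  have hq : ((p.map f).copy ha hb).IsPath := by
    simpa using hp.map hf
  have heq := (hT.existsUnique_path a b).unique hq hp
  have hs : p.support.map f = p.support := by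
    conv_rhs => rw [← heq]
    simp
  intro x hx
  have h2 : ∀ l : List V, l.map f = l → ∀ x ∈ l, f x = x := by
    intro l hl
    induction l with
    | nil => simp
    | cons c l ih =>
      simp only [List.map_cons, List.cons.injEq] at hl
      intro x hx
      rcases List.mem_cons.1 hx with rfl | hx
      · exact hl.1
      · exact ih hl.2 x hx
  exact h2 _ hs x hx

/-- cylinders are convex. -/
lemma aux_cyl_convex (hT : T.IsTree) (hact : ActsOn T G) (hinv : NoInversions T G)
    {E : Set (Subgroup G)} (hE : Admissible E) (hET : IsETree T G E)
    {Y : Set (Sym2 V)} (hY : IsCylinder T G Y) {v b : V} (hv : v ∈ cylVerts Y)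
    (hb : b ∈ cylVerts Y) (p : T.Walk v b) (hp : p.IsPath) {f : Sym2 V} (hf : f ∈ p.edges) :
    f ∈ Y := by
  obtain ⟨-, hYT, hYc⟩ := hY
  obtain ⟨e, he, hve⟩ := hv
  obtain ⟨e', he', hbe⟩ := hb
  have hfT : f ∈ T.edgeSet := p.edges_subset_edgeSet hf
  rw [hYc e he f hfT]
  have hc := (hYc e he e' (hYT he')).1 he'
  set A := edgeStab G e
  set B := edgeStab G e'
  have hle : A ⊓ B ≤ edgeStab G f := by
    rintro g ⟨hgA, hgB⟩
    have hgv : g • v = v := by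
      obtain ⟨c, rfl⟩ := Sym2.mem_iff_exists.1 hve
      exact (aux_edge_fix hinv (hYT he) hgA).1
    have hgb : g • b = b := by
      obtain ⟨c, rfl⟩ := Sym2.mem_iff_exists.1 hbe
      exact (aux_edge_fix hinv (hYT he') hgB).1
    have hfix := aux_path_fix hT hact hgv hgb p hp
    induction f using Sym2.ind with
    | _ c d =>
      show Sym2.map (g • ·) s(c, d) = s(c, d)
      rw [Sym2.map_mk, hfix c (p.fst_mem_support_of_mem_edges hf),
        hfix d (p.snd_mem_support_of_mem_edges hf)]
  have hAB : Subgroup.Commensurable (A ⊓ B) A := by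
    refine ⟨?_, ?_⟩
    · rw [Subgroup.inf_relIndex_left]
      exact hc.2
    · rw [Subgroup.relIndex_eq_one.2 inf_le_left]
      exact one_ne_zero
  have hABE : A ⊓ B ∈ E := hE.2.1 A (hET e (hYT he)) _ hAB
  refine hAB.symm.trans ⟨hE.2.2 _ hABE _ (hET f hfT) hle, ?_⟩
  rw [Subgroup.relIndex_eq_one.2 hle]
  exact one_ne_zero

end AuxG

/-- An infinite connected non-peripheral special forest `S` based on a
cylinder `Y` contains an edge `e ⊆ S ∩ Y` such that both components of `S` minus the open
edge `e` are infinite. -/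
theorem stmt_10 {G V : Type*} [Group G] [MulAction G V]
    (hGfg : Group.FG G)
    (T : SimpleGraph V) (hT : T.IsTree) (hact : ActsOn T G) (hinv : NoInversions T G)
    (E : Set (Subgroup G)) (hE : Admissible E) (hET : IsETree T G E)
    (hmin : MinimalAction T G)
    (hval3 : ∀ w : V, ∃ a b c : V, a ≠ b ∧ a ≠ c ∧ b ≠ c ∧ T.Adj w a ∧ T.Adj w b ∧ T.Adj w c)
    (Y : Set (Sym2 V)) (hY : IsCylinder T G Y)
    (S : Set V) (hS : IsSpecialForest T S Y) (hSinf : S.Infinite)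
    (hconn : ∀ u ∈ S, ∀ w ∈ S, ∃ p : T.Walk u w, ∀ x ∈ p.support, x ∈ S)
    (hnp : ¬ PeripheralForest T G S) :
    ∃ u w : V, T.Adj u w ∧ u ∈ S ∧ w ∈ S ∧ s(u, w) ∈ Y ∧
      {x : V | x ∈ S ∧ ∃ p : T.Walk u x, p.IsPath ∧ (∀ y ∈ p.support, y ∈ S) ∧
        s(u, w) ∉ p.edges}.Infinite ∧
      {x : V | x ∈ S ∧ ∃ p : T.Walk w x, p.IsPath ∧ (∀ y ∈ p.support, y ∈ S) ∧
        s(u, w) ∉ p.edges}.Infinite := by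
  classical
  by_contra hcon
  have hDfin : (auxD T S).Finite := auxD_finite hS.1
  -- every edge of `S ∩ Y` has a finite side
  have hside : ∀ u w : V, T.Adj u w → u ∈ S → w ∈ S → s(u, w) ∈ Y →
      (auxC T S u w).Finite ∨ (auxC T S w u).Finite := by
    intro u w huw hu hw hY'
    by_contra hne
    rw [not_or] at hne
    refine hcon ⟨u, w, huw, hu, hw, hY', ?_, ?_⟩
    · exact Set.Infinite.mono (auxC_subset_comp hT hconn hu) hne.1
    · have := Set.Infinite.mono (auxC_subset_comp hT hconn hw) hne.2
      rwa [Sym2.eq_swap] at this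
  -- a sink
  have hsink : ∃ v ∈ S, v ∈ cylVerts Y ∧ ∀ z, T.Adj v z → z ∈ S → s(v, z) ∈ Y →
      (auxC T S z v).Finite := by
    let P : Set (V × V) := {q | T.Adj q.1 q.2 ∧ q.1 ∈ S ∧ q.2 ∈ S ∧ s(q.1, q.2) ∈ Y ∧
      (auxC T S q.1 q.2).Finite}
    by_cases hP : P.Nonempty
    · have hfin : ((fun q : V × V => auxD T S ∩ auxC T S q.1 q.2) '' P).Finite := by
        refine hDfin.finite_subsets.subset ?_
        rintro _ ⟨q, _, rfl⟩
        exact Set.inter_subset_left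
      obtain ⟨⟨u, w⟩, ⟨huw, hu, hw, huwY, hf⟩, hmax⟩ :=
        Set.Finite.exists_maximalFor' (fun q : V × V => auxD T S ∩ auxC T S q.1 q.2) P hfin hP
      simp only at huw hu hw huwY hf
      refine ⟨w, hw, ⟨s(u, w), huwY, by simp⟩, fun z hwz hz hwzY => ?_⟩
      by_cases huz : u = z
      · exact huz ▸ hf
      rcases hside w z hwz hw hz hwzY with h | h
      · exfalso
        obtain ⟨d, hd, hdn⟩ := aux_ssubset hT hval3 huw hwz hw huz h
        have := hmax (j := (w, z)) ⟨hwz, hw, hz, hwzY, h⟩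
          (Set.inter_subset_inter_right _ (auxC_subset hT huw hwz huz))
        exact hdn (this hd).2
      · exact h
    · have hno : ∀ u w : V, T.Adj u w → u ∈ S → w ∈ S → s(u, w) ∉ Y := by
        intro u w huw hu hw huwY
        rcases hside u w huw hu hw huwY with h | h
        · exact hP ⟨(u, w), huw, hu, hw, huwY, h⟩
        · exact hP ⟨(w, u), huw.symm, hw, hu, by rw [Sym2.eq_swap]; exact huwY, h⟩
      obtain ⟨s, hs⟩ := hSinf.nonempty
      have hns : ∃ t, t ∉ S := by
        by_contra hall
        push Not at hall
        obtain ⟨e, he⟩ := hY.1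
        induction e using Sym2.ind with
        | _ a b => exact hno a b (hY.2.1 he) (hall a) (hall b) he
      obtain ⟨t, ht⟩ := hns
      obtain ⟨p⟩ := hT.connected.preconnected s t
      obtain ⟨d, -, hd1, hd2⟩ := p.exists_boundary_dart S hs ht
      refine ⟨d.fst, hd1, ⟨s(d.fst, d.snd), hS.2 ⟨d.adj, _, _, rfl, hd1, hd2⟩, by simp⟩, ?_⟩
      intro z hz hzS hzY
      exact absurd hzY (hno _ _ hz hd1 hzS)
  obtain ⟨v, hvS, hvY, hv⟩ := hsink
  let N : Set V := {z | T.Adj v z ∧ z ∈ S ∧ s(v, z) ∈ Y}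
  have hNfin : N.Finite := by
    have hch : ∀ z : V, ∃ d : V, z ∈ N → d ∈ auxD T S ∩ auxC T S z v := by
      intro z
      by_cases hz : z ∈ N
      · obtain ⟨d, hd⟩ := aux_exists_D hT hval3 hz.1.symm hz.2.1 (hv z hz.1 hz.2.1 hz.2.2)
        exact ⟨d, fun _ => hd⟩
      · exact ⟨v, fun h => absurd h hz⟩
    choose d hd using hch
    refine Set.Finite.of_finite_image (f := d) (hDfin.subset ?_) ?_
    · rintro _ ⟨z, hz, rfl⟩
      exact (hd z hz).1
    · intro z hz z' hz' heq
      have h1 := (hd z hz).2.2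
      have h2 := (hd z' hz').2.2
      rw [← heq] at h2
      exact aux_closer_unique hT hz.1 hz'.1 h1 h2
  have hval : FiniteValenceIn Y v := by
    refine (hS.1.union (hNfin.image fun z => s(v, z))).subset ?_
    rintro e ⟨he, hve⟩
    obtain ⟨z, rfl⟩ := Sym2.mem_iff_exists.1 hve
    by_cases hz : z ∈ S
    · exact Or.inr ⟨z, ⟨hY.2.1 he, hz, he⟩, rfl⟩
    · exact Or.inl ⟨hY.2.1 he, v, z, rfl, hvS, hz⟩
  have hsub : periForest T Y v ⊆ S := by
    rintro x ⟨p, hp, hpe⟩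
    by_contra hx
    obtain ⟨d, hdp, hd1, hd2⟩ := p.exists_boundary_dart S hvS hx
    have hdY : s(d.fst, d.snd) ∈ Y := hS.2 ⟨d.adj, _, _, rfl, hd1, hd2⟩
    have hds : d.snd ∈ p.support := p.dart_snd_mem_support_of_mem_darts hdp
    have hpath := hp.takeUntil hds
    have hne : v ≠ d.snd := fun h => hd2 (h ▸ hvS)
    have key : ∀ f ∈ (p.takeUntil d.snd hds).edges, f ∈ Y := fun f hf =>
      aux_cyl_convex hT hact hinv hE hET hY hvY ⟨_, hdY, by simp⟩ _ hpath hf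
    have hsubE := p.edges_takeUntil_subset_edges hds
    generalize p.takeUntil d.snd hds = q at *
    cases q with
    | nil => exact hne rfl
    | @cons _ a _ h q =>
      exact hpe s(v, a) (key _ (by simp)) (by simp) (hsubE (by simp))
  have hdiff : S \ periForest T Y v ⊆ ⋃ z ∈ N, auxC T S z v := by
    rintro x ⟨hx, hxn⟩
    obtain ⟨p, hp, -⟩ := hT.existsUnique_path v x
    have hex : ∃ e ∈ Y, v ∈ e ∧ e ∈ p.edges := by
      by_contra hne
      push Not at hne
      exact hxn ⟨p, hp, hne⟩
    obtain ⟨e, heY, hve, hep⟩ := hex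
    have hpS := aux_convex hT hconn hvS hx p hp
    cases p with
    | nil => simp at hep
    | @cons _ a _ h q =>
      have := aux_first_edge h q hp hve hep
      subst this
      simp only [Set.mem_iUnion]
      exact ⟨a, ⟨h, hpS a (by simp), heY⟩, hx, aux_cons_dist hT h q hp⟩
  have hdfin : (S \ periForest T Y v).Finite :=
    (hNfin.biUnion fun z hz => hv z hz.1 hz.2.1 hz.2.2).subset hdiff
  have hbd : v ∈ cylBoundary T Y := by
    refine ⟨hvY, ?_⟩
    by_contra hne
    push Not at hne
    have hsing : periForest T Y v ⊆ {v} := by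
      rintro x ⟨p, hp, hpe⟩
      cases p with
      | nil => simp
      | @cons _ a _ h q =>
        exact absurd (by simp) (hpe s(v, a) (hne s(v, a) h (by simp)) (by simp))
    refine hSinf ((hdfin.union ((Set.finite_singleton v).subset hsing)).subset ?_)
    intro x hx
    by_cases h : x ∈ periForest T Y v
    · exact Or.inr h
    · exact Or.inl ⟨hx, h⟩
  refine hnp ⟨Y, v, hY, hbd, hval, ?_⟩
  rw [Set.symmDiff_def, Set.sdiff_eq_empty.2 hsub, Set.union_empty]
  exact hdfin

end SSRN
end
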